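/- Let Λ be an almost n-minimal Auslander-Gorenstein algebra with n ≥ 2, i.e., an Artin algebra such that, for the injective module I with add I = {finitely generated injective Λ-modules of projective dimension at most 1}, one has id Λ ≤ n+1 ≤ I-domdim Λ. Let A = End_Λ(I) and let M = I viewed as a left A-module. Then for every finitely generated A-module X with Ext^i_A(M,X) = 0 for all 1 ≤ i ≤ n−1, the Λ-module Hom_A(X,M) (a left module over Λ ≅ End_A(M)) is Gorenstein projective, i.e., Ext^i_Λ(Hom_A(X,M), Λ) = 0 for all i ≥ 1. -/

import Mathlib

open CategoryTheory

universe u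

noncomputable instance hasExtModuleCat (A : Type u) [Ring A] : HasExt.{u+1} (ModuleCat.{u} A) :=
  letI := HasDerivedCategory.standard (ModuleCat.{u} A)
  hasExt_of_hasDerivedCategory _

/-- `Ext^i_A(X, Y) = 0`. -/
def ExtVanishes (A : Type u) [Ring A] (X Y : Type u) [AddCommGroup X] [Module A X]
    [AddCommGroup Y] [Module A Y] (i : ℕ) : Prop :=
  Subsingleton (Abelian.Ext (ModuleCat.of A X) (ModuleCat.of A Y) i)

/-- `X ∈ add M`: `X` is a direct summand of a finite direct sum of copies of `M`. -/
def InAdd (Λ : Type u) [Ring Λ] (M : Type u) [AddCommGroup M] [Module Λ M]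
    (X : Type u) [AddCommGroup X] [Module Λ X] : Prop :=
  ∃ (k : ℕ) (ι : X →ₗ[Λ] (Fin k → M)) (π : (Fin k → M) →ₗ[Λ] X), π ∘ₗ ι = LinearMap.id

/-- `I`-domdim of `Y` is at least `t`: there is an exact sequence
`0 → Y → J_0 → ⋯ → J_{t-1}` with all `J_i ∈ add I`. -/
def IDomdimGE (Λ : Type u) [Ring Λ] (I : Type u) [AddCommGroup I] [Module Λ I]
    (Y : Type u) [AddCommGroup Y] [Module Λ Y] (t : ℕ) : Prop :=
  ∃ (J : ℕ → ModuleCat.{u} Λ) (g : Y →ₗ[Λ] J 0) (f : ∀ i, (J i : Type u) →ₗ[Λ] J (i+1)),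
    (∀ i < t, InAdd Λ I (J i)) ∧
    (1 ≤ t → Function.Injective g) ∧
    (2 ≤ t → Function.Exact g (f 0)) ∧
    (∀ i, i + 3 ≤ t → Function.Exact (f i) (f (i+1)))

/-- The projective dimension of `N` is at most `m`: there is a projective resolution
`0 → P_m → ⋯ → P_0 → N → 0`. -/
def ProjDimLE (Λ : Type u) [Ring Λ] (N : Type u) [AddCommGroup N] [Module Λ N] (m : ℕ) : Prop :=
  ∃ (P : ℕ → ModuleCat.{u} Λ) (f : ∀ i, (P (i+1) : Type u) →ₗ[Λ] P i) (g : (P 0 : Type u) →ₗ[Λ] N),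
    (∀ i, Module.Projective Λ (P i)) ∧
    (∀ i, m < i → Subsingleton (P i)) ∧
    Function.Surjective g ∧ Function.Exact (f 0) g ∧
    (∀ i, Function.Exact (f (i+1)) (f i))

/-- The injective dimension of `N` is at most `m`: there is an injective coresolution
`0 → N → J_0 → ⋯ → J_m → 0`. -/
def InjDimLE (Λ : Type u) [Ring Λ] (N : Type u) [AddCommGroup N] [Module Λ N] (m : ℕ) : Prop :=
  ∃ (J : ℕ → ModuleCat.{u} Λ) (g : N →ₗ[Λ] J 0) (f : ∀ i, (J i : Type u) →ₗ[Λ] J (i+1)),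
    (∀ i, Module.Injective Λ (J i)) ∧
    (∀ i, m < i → Subsingleton (J i)) ∧
    Function.Injective g ∧ Function.Exact g (f 0) ∧
    (∀ i, Function.Exact (f i) (f (i+1)))

/-- `M` is a cogenerator: every finitely generated module embeds into a finite
direct sum of copies of `M`. -/
def IsCogenerator (A : Type u) [Ring A] (M : Type u) [AddCommGroup M] [Module A M] : Prop :=
  ∀ (X : Type u) [AddCommGroup X] [Module A X], Module.Finite A X →
    ∃ (k : ℕ) (f : X →ₗ[A] (Fin k → M)), Function.Injective f

/-- `M`-codim `A ≤ m`: there is an exact sequence `0 → A → M_0 → ⋯ → M_m → 0` with all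
`M_i ∈ add M` which stays exact after applying `Hom_A(-, M)`. -/
def MCodimLE (A : Type u) [Ring A] (M : Type u) [AddCommGroup M] [Module A M] (m : ℕ) : Prop :=
  ∃ (C : ℕ → ModuleCat.{u} A) (g : A →ₗ[A] C 0) (f : ∀ i, (C i : Type u) →ₗ[A] C (i+1)),
    (∀ i ≤ m, InAdd A M (C i)) ∧
    (∀ i, m < i → Subsingleton (C i)) ∧
    Function.Injective g ∧ Function.Exact g (f 0) ∧
    (∀ i, Function.Exact (f i) (f (i+1))) ∧
    Function.Surjective (fun φ : (C 0 : Type u) →ₗ[A] M => φ ∘ₗ g) ∧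
    Function.Exact (fun φ : (C 1 : Type u) →ₗ[A] M => φ ∘ₗ (f 0))
      (fun φ : (C 0 : Type u) →ₗ[A] M => φ ∘ₗ g) ∧
    (∀ i, Function.Exact (fun φ : (C (i+2) : Type u) →ₗ[A] M => φ ∘ₗ (f (i+1)))
      (fun φ : (C (i+1) : Type u) →ₗ[A] M => φ ∘ₗ (f i)))

/-- The canonical ring homomorphism from `Λ` to the endomorphism ring of `I` over
`End_Λ(I)`, sending `λ` to multiplication by `λ`. -/
@[simps] def evalRingHom (Λ : Type u) [Ring Λ] (I : Type u) [AddCommGroup I] [Module Λ I] :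
    Λ →+* Module.End (Module.End Λ I) I where
  toFun a :=
    { toFun := fun x => a • x
      map_add' := fun x y => smul_add a x y
      map_smul' := fun φ x => (φ.map_smul a x).symm }
  map_one' := by ext x; simp
  map_mul' a b := by ext x; simp [mul_smul]
  map_zero' := by ext x; simp
  map_add' a b := by ext x; simp [add_smul]

section ShortExact

variable {A : Type u} [Ring A]
  {K : Type u} [AddCommGroup K] [Module A K] {P : Type u} [AddCommGroup P] [Module A P]
  {M : Type u} [AddCommGroup M] [Module A M] {f : K →ₗ[A] P} {g : P →ₗ[A] M}

lemma shortExact_of_linearMap (hf : Function.Injective f) (hfg : Function.Exact f g)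
    (hg : Function.Surjective g) :
    (ModuleCat.shortComplexOfCompEqZero f g hfg.linearMap_comp_eq_zero).ShortExact :=
  ModuleCat.shortComplex_shortExact _ hfg hf hg

lemma ExtVanishes.of_linearEquiv {X Y Y' : Type u} [AddCommGroup X] [Module A X]
    [AddCommGroup Y] [Module A Y] [AddCommGroup Y'] [Module A Y'] {i : ℕ}
    (h : ExtVanishes A X Y i) (e : Y ≃ₗ[A] Y') : ExtVanishes A X Y' i := by
  have : Subsingleton (Abelian.Ext (ModuleCat.of A X) (ModuleCat.of A Y) i) := h
  refine subsingleton_of_forall_eq 0 fun x => ?_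
  have hx : x.comp (Abelian.Ext.mk₀ e.toModuleIso.inv) (add_zero i) = 0 :=
    Subsingleton.elim _ _
  have := congr_arg (fun y => y.comp (Abelian.Ext.mk₀ e.toModuleIso.hom) (add_zero i)) hx
  simpa [-LinearEquiv.toModuleIso_hom, -LinearEquiv.toModuleIso_inv] using this

lemma extVanishes_of_projective [Module.Projective A P] (X : Type u) [AddCommGroup X]
    [Module A X] (i : ℕ) : ExtVanishes A P X (i + 1) := by
  have : Projective (ModuleCat.of A P) := (IsProjective.iff_projective P).mp inferInstance
  exact subsingleton_of_forall_eq 0 Abelian.Ext.eq_zero_of_projective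

lemma extVanishes_of_injective (hP : Module.Injective A P) (X : Type u) [AddCommGroup X]
    [Module A X] (i : ℕ) : ExtVanishes A X P (i + 1) := by
  have : Injective (ModuleCat.of A P) := (Module.injective_iff_injective_object A P).mp hP
  exact subsingleton_of_forall_eq 0 Abelian.Ext.eq_zero_of_injective

lemma ExtVanishes.left_of_shortExact (hf : Function.Injective f) (hfg : Function.Exact f g)
    (hg : Function.Surjective g) {X : Type u} [AddCommGroup X] [Module A X] {i : ℕ}
    (hP : ExtVanishes A P X i) (hM : ExtVanishes A M X (i + 1)) : ExtVanishes A K X i := by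
  have hS := shortExact_of_linearMap hf hfg hg
  have : Subsingleton (Abelian.Ext (ModuleCat.of A P) (ModuleCat.of A X) i) := hP
  have : Subsingleton (Abelian.Ext (ModuleCat.of A M) (ModuleCat.of A X) (i + 1)) := hM
  refine subsingleton_of_forall_eq 0 fun x => ?_
  obtain ⟨y, rfl⟩ := Abelian.Ext.contravariant_sequence_exact₁ hS _ x (add_comm 1 i)
    (Subsingleton.elim _ _)
  rw [Subsingleton.elim y 0, Abelian.Ext.comp_zero]

lemma ExtVanishes.right_of_shortExact (hf : Function.Injective f) (hfg : Function.Exact f g)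
    (hg : Function.Surjective g) {X : Type u} [AddCommGroup X] [Module A X] {i : ℕ}
    (hP : ExtVanishes A P X (i + 1)) (hK : ExtVanishes A K X i) :
    ExtVanishes A M X (i + 1) := by
  have hS := shortExact_of_linearMap hf hfg hg
  have : Subsingleton (Abelian.Ext (ModuleCat.of A P) (ModuleCat.of A X) (i + 1)) := hP
  have : Subsingleton (Abelian.Ext (ModuleCat.of A K) (ModuleCat.of A X) i) := hK
  refine subsingleton_of_forall_eq 0 fun x => ?_
  obtain ⟨y, rfl⟩ := Abelian.Ext.contravariant_sequence_exact₃ hS _ x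
    (Subsingleton.elim _ _) (add_comm 1 i)
  rw [Subsingleton.elim y 0, Abelian.Ext.comp_zero]

lemma extVanishes_one_iff_of_projective [Module.Projective A P] (hf : Function.Injective f)
    (hfg : Function.Exact f g) (hg : Function.Surjective g) (X : Type u) [AddCommGroup X]
    [Module A X] :
    ExtVanishes A M X 1 ↔ ∀ φ : K →ₗ[A] X, ∃ ψ : P →ₗ[A] X, ψ ∘ₗ f = φ := by
  have hS := shortExact_of_linearMap hf hfg hg
  constructor
  · intro h φ
    have : Subsingleton (Abelian.Ext (ModuleCat.of A M) (ModuleCat.of A X) 1) := h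
    obtain ⟨y, hy⟩ := Abelian.Ext.contravariant_sequence_exact₁ hS _
      (Abelian.Ext.mk₀ (ModuleCat.ofHom φ)) (add_zero 1) (Subsingleton.elim _ _)
    obtain ⟨ψ, rfl⟩ := Abelian.Ext.addEquiv₀.symm.surjective y
    rw [Abelian.Ext.addEquiv₀_symm_apply, Abelian.Ext.mk₀_comp_mk₀] at hy
    exact ⟨ψ.hom, congr_arg ModuleCat.Hom.hom (Abelian.Ext.addEquiv₀.symm.injective hy)⟩
  · intro h
    have : Subsingleton (Abelian.Ext (ModuleCat.of A P) (ModuleCat.of A X) 1) :=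
      extVanishes_of_projective X 0
    refine subsingleton_of_forall_eq 0 fun x => ?_
    obtain ⟨y, rfl⟩ := Abelian.Ext.contravariant_sequence_exact₃ hS _ x
      (Subsingleton.elim _ _) (add_zero 1)
    obtain ⟨φ, rfl⟩ := Abelian.Ext.addEquiv₀.symm.surjective y
    obtain ⟨ψ, hψ⟩ := h φ.hom
    have hφ : φ = ModuleCat.ofHom f ≫ ModuleCat.ofHom ψ := ModuleCat.hom_ext hψ.symm
    subst hφ
    rw [Abelian.Ext.addEquiv₀_symm_apply, ← Abelian.Ext.mk₀_comp_mk₀]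
    exact hS.extClass_comp_assoc _

lemma extVanishes_one_of_forall_exists (hP : Module.Injective A P) (hf : Function.Injective f)
    (hfg : Function.Exact f g) (hg : Function.Surjective g) (X : Type u) [AddCommGroup X]
    [Module A X] (h : ∀ φ : X →ₗ[A] M, ∃ ψ : X →ₗ[A] P, g ∘ₗ ψ = φ) :
    ExtVanishes A X K 1 := by
  have hS := shortExact_of_linearMap hf hfg hg
  have : Subsingleton (Abelian.Ext (ModuleCat.of A X) (ModuleCat.of A P) 1) :=
    extVanishes_of_injective hP X 0
  refine subsingleton_of_forall_eq 0 fun x => ?_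
  obtain ⟨y, rfl⟩ := Abelian.Ext.covariant_sequence_exact₁ _ hS x
    (Subsingleton.elim _ _) (zero_add 1)
  obtain ⟨φ, rfl⟩ := Abelian.Ext.addEquiv₀.symm.surjective y
  obtain ⟨ψ, hψ⟩ := h φ.hom
  have hφ : φ = ModuleCat.ofHom ψ ≫ ModuleCat.ofHom g := ModuleCat.hom_ext hψ.symm
  subst hφ
  rw [Abelian.Ext.addEquiv₀_symm_apply, ← Abelian.Ext.mk₀_comp_mk₀,
    Abelian.Ext.comp_assoc_of_second_deg_zero]
  erw [hS.comp_extClass, Abelian.Ext.comp_zero]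

lemma ExtVanishes.of_injective_shortExact (hP : Module.Injective A P)
    (hf : Function.Injective f) (hfg : Function.Exact f g) (hg : Function.Surjective g)
    {X : Type u} [AddCommGroup X] [Module A X] {i : ℕ} (h : ExtVanishes A X M (i + 1)) :
    ExtVanishes A X K (i + 2) := by
  have hS := shortExact_of_linearMap hf hfg hg
  have : Subsingleton (Abelian.Ext (ModuleCat.of A X) (ModuleCat.of A P) (i + 2)) :=
    extVanishes_of_injective hP X (i + 1)
  have : Subsingleton (Abelian.Ext (ModuleCat.of A X) (ModuleCat.of A M) (i + 1)) := h
  refine subsingleton_of_forall_eq 0 fun x => ?_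
  obtain ⟨y, rfl⟩ := Abelian.Ext.covariant_sequence_exact₁ _ hS x
    (Subsingleton.elim _ _) rfl
  rw [Subsingleton.elim y 0, Abelian.Ext.zero_comp]

end ShortExact

section Resolution

variable {A : Type u} [Ring A]

lemma exists_comp_eq_of_surjective {P K X : Type u} [AddCommGroup P] [Module A P]
    [AddCommGroup K] [Module A K] [AddCommGroup X] [Module A X] {q : P →ₗ[A] K}
    (hq : Function.Surjective q) (φ : P →ₗ[A] X) (h : LinearMap.ker q ≤ LinearMap.ker φ) :
    ∃ ψ : K →ₗ[A] X, ψ ∘ₗ q = φ := by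
  refine ⟨(LinearMap.ker q).liftQ φ h ∘ₗ (q.quotKerEquivOfSurjective hq).symm.toLinearMap, ?_⟩
  ext x
  have : (q.quotKerEquivOfSurjective hq).symm (q x) = (LinearMap.ker q).mkQ x := by
    rw [LinearEquiv.symm_apply_eq]; rfl
  simp [this]

lemma extVanishes_of_injective_coresolution {N : Type u} [AddCommGroup N] [Module A N] (i : ℕ) :
    ∀ {Y : Type u} [AddCommGroup Y] [Module A Y] {J : ℕ → ModuleCat.{u} A} {g : Y →ₗ[A] J 0}
      {f : ∀ k, (J k : Type u) →ₗ[A] J (k + 1)}, (∀ k ≤ i, Module.Injective A (J k)) →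
      Function.Injective g → Function.Exact g (f 0) →
      (∀ k ≤ i, Function.Exact (f k) (f (k + 1))) →
      (∀ φ : N →ₗ[A] J (i + 1), f (i + 1) ∘ₗ φ = 0 → ∃ ψ : N →ₗ[A] J i, f i ∘ₗ ψ = φ) →
      ExtVanishes A N Y (i + 1) := by
  have key : ∀ {Y : Type u} [AddCommGroup Y] [Module A Y] {J J' : Type u} [AddCommGroup J]
      [Module A J] [AddCommGroup J'] [Module A J'] {g : Y →ₗ[A] J} {f : J →ₗ[A] J'},
      Function.Exact g f → Function.Exact g f.rangeRestrict := fun h x => by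
    rw [← h x, Subtype.ext_iff]; rfl
  induction i with
  | zero =>
    intro Y _ _ J g f hJ hg h0 hf h
    refine extVanishes_one_of_forall_exists (hJ 0 le_rfl) hg (key h0)
      (f 0).surjective_rangeRestrict N fun φ => ?_
    obtain ⟨ψ, hψ⟩ := h ((LinearMap.range (f 0)).subtype ∘ₗ φ) (by
      ext x
      exact (hf 0 le_rfl _).2 (φ x).2)
    exact ⟨ψ, LinearMap.ext fun x => Subtype.ext (LinearMap.congr_fun hψ x)⟩
  | succ i ih =>
    intro Y _ _ J g f hJ hg h0 hf h
    refine ExtVanishes.of_injective_shortExact (hJ 0 (Nat.zero_le _)) hg (key h0)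
      (f 0).surjective_rangeRestrict ?_
    refine ih (J := fun k => J (k + 1)) (f := fun k => f (k + 1))
      (g := (LinearMap.range (f 0)).subtype) (fun k hk => hJ _ (Nat.succ_le_succ hk))
      Subtype.val_injective ?_ (fun k hk => hf _ (Nat.succ_le_succ hk)) h
    intro x
    rw [hf 0 (Nat.zero_le _) x]
    simp

lemma extVanishes_iff_of_projective_resolution {X : Type u} [AddCommGroup X] [Module A X]
    (i : ℕ) :
    ∀ {M : Type u} [AddCommGroup M] [Module A M] {P : ℕ → Type u} [∀ k, AddCommGroup (P k)]
      [∀ k, Module A (P k)] {g : P 0 →ₗ[A] M}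
      {f : ∀ k, P (k + 1) →ₗ[A] P k}, (∀ k ≤ i, Module.Projective A (P k)) →
      Function.Surjective g → Function.Exact (f 0) g →
      (∀ k ≤ i, Function.Exact (f (k + 1)) (f k)) →
      (ExtVanishes A M X (i + 1) ↔
        ∀ φ : P (i + 1) →ₗ[A] X, φ ∘ₗ f (i + 1) = 0 → ∃ ψ : P i →ₗ[A] X, ψ ∘ₗ f i = φ) := by
  have key : ∀ {M : Type u} [AddCommGroup M] [Module A M] {P P' : Type u} [AddCommGroup P]
      [Module A P] [AddCommGroup P'] [Module A P'] {g : P →ₗ[A] M} {f : P' →ₗ[A] P},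
      Function.Exact f g → Function.Exact (LinearMap.range f).subtype g := fun h x => by
    rw [h x]; simp
  induction i with
  | zero =>
    intro M _ _ P _ _ g f hP hg h0 hf
    have := hP 0 le_rfl
    rw [extVanishes_one_iff_of_projective Subtype.val_injective (key h0) hg]
    constructor
    · intro h φ hφ
      obtain ⟨φ', rfl⟩ := exists_comp_eq_of_surjective (f 0).surjective_rangeRestrict φ (by
        intro x hx
        obtain ⟨y, rfl⟩ := (hf 0 le_rfl x).1 (congr_arg Subtype.val hx)
        exact LinearMap.congr_fun hφ y)
      obtain ⟨ψ, rfl⟩ := h φ'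
      exact ⟨ψ, rfl⟩
    · intro h φ
      obtain ⟨ψ, hψ⟩ := h (φ ∘ₗ (f 0).rangeRestrict) (by
        ext x
        have : (f 0).rangeRestrict (f 1 x) = 0 :=
          Subtype.ext ((hf 0 le_rfl _).2 ⟨x, rfl⟩)
        simp [this])
      refine ⟨ψ, LinearMap.ext ?_⟩
      rintro ⟨_, x, rfl⟩
      exact LinearMap.congr_fun hψ x
  | succ i ih =>
    intro M _ _ P _ _ g f hP hg h0 hf
    have := hP 0 (Nat.zero_le _)
    rw [← ih (P := fun k => P (k + 1)) (f := fun k => f (k + 1)) (g := (f 0).rangeRestrict)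
      (fun k hk => hP _ (Nat.succ_le_succ hk)) (f 0).surjective_rangeRestrict
      (fun x => by rw [← hf 0 (Nat.zero_le _) x, Subtype.ext_iff]; rfl)
      (fun k hk => hf _ (Nat.succ_le_succ hk))]
    exact ⟨ExtVanishes.left_of_shortExact Subtype.val_injective (key h0) hg
      (extVanishes_of_projective X i), ExtVanishes.right_of_shortExact Subtype.val_injective
      (key h0) hg (extVanishes_of_projective X _)⟩

lemma InjDimLE.extVanishes {Y : Type u} [AddCommGroup Y] [Module A Y] {m : ℕ}
    (h : InjDimLE A Y m) (N : Type u) [AddCommGroup N] [Module A N] {i : ℕ} (hi : m < i) :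
    ExtVanishes A N Y i := by
  obtain ⟨J, g, f, hJ, hJ0, hg, h0, hf⟩ := h
  obtain ⟨i, rfl⟩ := Nat.exists_eq_add_one_of_ne_zero (Nat.ne_zero_of_lt hi)
  have := hJ0 _ hi
  exact extVanishes_of_injective_coresolution i (fun k _ => hJ k) hg h0 (fun k _ => hf k)
    fun φ _ => ⟨0, LinearMap.ext fun x => Subsingleton.elim _ _⟩

lemma ProjDimLE.extVanishes {N : Type u} [AddCommGroup N] [Module A N] {m : ℕ}
    (h : ProjDimLE A N m) (Y : Type u) [AddCommGroup Y] [Module A Y] {i : ℕ} (hi : m < i) :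
    ExtVanishes A N Y i := by
  obtain ⟨P, f, g, hP, hP0, hg, h0, hf⟩ := h
  obtain ⟨i, rfl⟩ := Nat.exists_eq_add_one_of_ne_zero (Nat.ne_zero_of_lt hi)
  have := hP0 _ hi
  refine (extVanishes_iff_of_projective_resolution (P := fun k => P k) i (fun k _ => hP k) hg h0
    (fun k _ => hf k)).2 fun φ _ => ⟨0, LinearMap.ext fun x => ?_⟩
  rw [Subsingleton.elim x 0, map_zero, map_zero]

end Resolution

section Dual

variable {Λ : Type u} [Ring Λ] {I : Type u} [AddCommGroup I] [Module Λ I]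

lemma InAdd.finite [Module.Finite Λ I] {J : Type u} [AddCommGroup J] [Module Λ J]
    (h : InAdd Λ I J) : Module.Finite Λ J := by
  obtain ⟨k, ι, π, h⟩ := h
  exact Module.Finite.of_surjective π fun x => ⟨ι x, LinearMap.congr_fun h x⟩

lemma exact_lcomp_of_injective (hI : Module.Injective Λ I) {X Y Z : Type u} [AddCommGroup X]
    [Module Λ X] [AddCommGroup Y] [Module Λ Y] [AddCommGroup Z] [Module Λ Z] {f : X →ₗ[Λ] Y}
    {g : Y →ₗ[Λ] Z} (h : Function.Exact f g) :
    Function.Exact (LinearMap.lcomp (Module.End Λ I) I g)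
      (LinearMap.lcomp (Module.End Λ I) I f) := by
  intro φ
  constructor
  · intro hφ
    obtain ⟨φ', rfl⟩ := exists_comp_eq_of_surjective g.surjective_rangeRestrict φ (by
      intro y hy
      obtain ⟨x, rfl⟩ := (h y).1 (congr_arg Subtype.val hy)
      exact LinearMap.congr_fun hφ x)
    obtain ⟨ψ, rfl⟩ := Module.Injective.extension_property Λ I _ _
      (LinearMap.range g).subtype Subtype.val_injective φ'
    exact ⟨ψ, rfl⟩
  · rintro ⟨ψ, rfl⟩
    ext x
    simp [h.apply_apply_eq_zero]

lemma InAdd.eq_of_lcomp_eq {J : Type u} [AddCommGroup J] [Module Λ J] (hJ : InAdd Λ I J)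
    {N : Type u} [AddCommGroup N] [Module Λ N] {φ ψ : N →ₗ[Λ] J}
    (h : ∀ χ : J →ₗ[Λ] I, χ ∘ₗ φ = χ ∘ₗ ψ) : φ = ψ := by
  obtain ⟨k, ι, π, hπ⟩ := hJ
  ext x
  have hι : ι (φ x) = ι (ψ x) :=
    funext fun j => LinearMap.congr_fun (h (LinearMap.proj j ∘ₗ ι)) x
  exact (LinearMap.congr_fun hπ _).symm.trans
    ((congr_arg π hι).trans (LinearMap.congr_fun hπ _))

lemma linearMap_apply_eq_sum_single {k : ℕ} {J : Type u} [AddCommGroup J] [Module Λ J]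
    (χ : (Fin k → I) →ₗ[Λ] J) (v : Fin k → I) : χ v = ∑ j, χ (Pi.single j (v j)) := by
  rw [← map_sum, Finset.univ_sum_single]

lemma eq_sum_smul_proj_of_retract {J : Type u} [AddCommGroup J] [Module Λ J] {k : ℕ}
    {ι : J →ₗ[Λ] (Fin k → I)} {π : (Fin k → I) →ₗ[Λ] J} (hπ : π ∘ₗ ι = LinearMap.id)
    (χ : J →ₗ[Λ] I) :
    χ = ∑ j, (χ ∘ₗ π ∘ₗ LinearMap.single Λ (fun _ => I) j : Module.End Λ I) •
      (LinearMap.proj j ∘ₗ ι) := by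
  ext x
  have hx : χ x = (χ ∘ₗ π) (ι x) := congr_arg χ (LinearMap.congr_fun hπ x).symm
  rw [hx, linearMap_apply_eq_sum_single, LinearMap.sum_apply]
  rfl

lemma InAdd.exists_lcomp_eq {J : Type u} [AddCommGroup J] [Module Λ J] (hJ : InAdd Λ I J)
    {N : Type u} [AddCommGroup N] [Module Λ N]
    (ψ : (J →ₗ[Λ] I) →ₗ[Module.End Λ I] (N →ₗ[Λ] I)) :
    ∃ θ : N →ₗ[Λ] J, ∀ χ : J →ₗ[Λ] I, χ ∘ₗ θ = ψ χ := by
  obtain ⟨k, ι, π, hπ⟩ := hJ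
  refine ⟨π ∘ₗ LinearMap.pi fun j => ψ (LinearMap.proj j ∘ₗ ι), fun χ => ?_⟩
  conv_rhs => rw [eq_sum_smul_proj_of_retract hπ χ, map_sum]
  ext x
  rw [LinearMap.sum_apply, ← LinearMap.comp_assoc, LinearMap.comp_apply,
    linearMap_apply_eq_sum_single]
  simp

lemma InAdd.projective_dual {J : Type u} [AddCommGroup J] [Module Λ J] (hJ : InAdd Λ I J) :
    Module.Projective (Module.End Λ I) (J →ₗ[Λ] I) := by
  obtain ⟨k, ι, π, hπ⟩ := hJ
  let s : (J →ₗ[Λ] I) →ₗ[Module.End Λ I] (Fin k → Module.End Λ I) :=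
    { toFun := fun χ j => χ ∘ₗ π ∘ₗ LinearMap.single Λ (fun _ => I) j
      map_add' := fun _ _ => rfl
      map_smul' := fun _ _ => rfl }
  let r : (Fin k → Module.End Λ I) →ₗ[Module.End Λ I] (J →ₗ[Λ] I) :=
    { toFun := fun v => ∑ j, v j • (LinearMap.proj j ∘ₗ ι)
      map_add' := fun v w => by simp [add_smul, Finset.sum_add_distrib]
      map_smul' := fun a v => by simp [mul_smul, Finset.smul_sum] }
  exact Module.Projective.of_split s r
    (LinearMap.ext fun χ => (eq_sum_smul_proj_of_retract hπ χ).symm)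

/-- The evaluation map from an `End_Λ(I)`-module `X` to its double dual with respect to `I`. -/
@[simps]
def evalDual (Λ I X : Type u) [Ring Λ] [AddCommGroup I] [Module Λ I] [AddCommGroup X]
    [Module (Module.End Λ I) X] :
    X →ₗ[Module.End Λ I] ((X →ₗ[Module.End Λ I] I) →ₗ[Λ] I) where
  toFun x :=
    { toFun := fun θ => θ x
      map_add' := fun _ _ => rfl
      map_smul' := fun _ _ => rfl }
  map_add' x y := by ext; simp
  map_smul' a x := by ext; simp

/-- The homomorphism `End_Λ(I)^a → I` sending `w` to `w_j(m)`. -/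
@[simps]
def evalCoord (Λ : Type u) {I : Type u} [Ring Λ] [AddCommGroup I] [Module Λ I] {a : ℕ}
    (j : Fin a) (m : I) : (Fin a → Module.End Λ I) →ₗ[Module.End Λ I] I where
  toFun w := w j m
  map_add' _ _ := rfl
  map_smul' _ _ := rfl

lemma eq_sum_evalCoord {a : ℕ} (θ : (Fin a → Module.End Λ I) →ₗ[Module.End Λ I] I) :
    θ = ∑ j, evalCoord Λ j (θ (Pi.single j 1)) := by
  refine LinearMap.ext fun w => ?_
  have hw : w = ∑ j, w j • (Pi.single j 1 : Fin a → Module.End Λ I) := by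
    ext j; simp [Finset.sum_apply, Pi.single_apply]
  conv_lhs => rw [hw]
  simp [LinearMap.sum_apply]

lemma evalDual_pi_bijective (a : ℕ) :
    Function.Bijective (evalDual Λ I (Fin a → Module.End Λ I)) := by
  constructor
  · refine (injective_iff_map_eq_zero _).2 fun v hv => ?_
    ext j m
    exact LinearMap.congr_fun hv (evalCoord Λ j m)
  · intro h
    let v : Fin a → Module.End Λ I := fun j =>
      { toFun := fun m => h (evalCoord Λ j m)
        map_add' := fun m m' => by rw [← map_add]; congr 1; ext; simp
        map_smul' := fun c m => by
          rw [RingHom.id_apply, ← map_smul]; congr 1; ext; simp }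
    refine ⟨v, LinearMap.ext fun θ => ?_⟩
    conv_rhs => rw [eq_sum_evalCoord θ, map_sum]
    conv_lhs => rw [eq_sum_evalCoord θ, map_sum]
    simp [v]

lemma inAdd_dual_pi (a : ℕ) :
    InAdd Λ I ((Fin a → Module.End Λ I) →ₗ[Module.End Λ I] I) := by
  refine ⟨a, LinearMap.pi fun j => evalDual Λ I _ (Pi.single j 1),
    { toFun := fun m => ∑ j, evalCoord Λ j (m j)
      map_add' := fun m m' => ?_
      map_smul' := fun c m => ?_ }, ?_⟩
  · ext; simp [LinearMap.sum_apply, Finset.sum_add_distrib]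
  · ext; simp [Finset.smul_sum]
  · exact LinearMap.ext fun θ => (eq_sum_evalCoord θ).symm

section Presentation

variable {X P Q : Type u} [AddCommGroup X] [Module (Module.End Λ I) X] [AddCommGroup P]
  [Module (Module.End Λ I) P] [AddCommGroup Q] [Module (Module.End Λ I) Q]
  {q : Q →ₗ[Module.End Λ I] P} {p : P →ₗ[Module.End Λ I] X}

lemma lcomp_end_injective (hp : Function.Surjective p) :
    Function.Injective (LinearMap.lcomp Λ I p) := fun θ θ' h => by
  ext x
  obtain ⟨x, rfl⟩ := hp x
  exact LinearMap.congr_fun h x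

lemma exact_lcomp_end (hp : Function.Surjective p) (hqp : Function.Exact q p) :
    Function.Exact (LinearMap.lcomp Λ I p) (LinearMap.lcomp Λ I q) := by
  intro θ
  constructor
  · intro hθ
    obtain ⟨ψ, rfl⟩ := exists_comp_eq_of_surjective hp θ (by
      intro x hx
      obtain ⟨y, rfl⟩ := (hqp x).1 hx
      exact LinearMap.congr_fun hθ y)
    exact ⟨ψ, rfl⟩
  · rintro ⟨ψ, rfl⟩
    ext x
    simp [hqp.apply_apply_eq_zero]

lemma evalDual_bijective_of_presentation (hI : Module.Injective Λ I)
    (hp : Function.Surjective p) (hqp : Function.Exact q p)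
    (hP : Function.Bijective (evalDual Λ I P)) (hQ : Function.Surjective (evalDual Λ I Q)) :
    Function.Bijective (evalDual Λ I X) := by
  constructor
  · refine (injective_iff_map_eq_zero _).2 fun x hx => ?_
    obtain ⟨v, rfl⟩ := hp x
    obtain ⟨k, hk⟩ := (exact_lcomp_of_injective hI (exact_lcomp_end (Λ := Λ) hp hqp)
      (evalDual Λ I P v)).1 (LinearMap.ext fun θ => LinearMap.congr_fun hx θ)
    obtain ⟨w, rfl⟩ := hQ k
    have hv : q w = v := hP.1 (LinearMap.ext fun θ => LinearMap.congr_fun hk θ)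
    rw [← hv, hqp.apply_apply_eq_zero]
  · intro h
    obtain ⟨h', rfl⟩ := Module.Injective.extension_property Λ I _ _
      (LinearMap.lcomp Λ I p) (lcomp_end_injective hp) h
    obtain ⟨v, rfl⟩ := hP.2 h'
    exact ⟨p v, rfl⟩

end Presentation

lemma isNoetherianRing_end (R : Type u) [CommRing R] [IsNoetherianRing R] (Λ : Type u) [Ring Λ]
    [Algebra R Λ] [Module.Finite R Λ] (I : Type u) [AddCommGroup I] [Module Λ I]
    [Module.Finite Λ I] : IsNoetherianRing (Module.End Λ I) := by
  let _ : Module R I := Module.compHom I (algebraMap R Λ)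
  have : IsScalarTower R Λ I := .of_algebraMap_smul fun _ _ => rfl
  have : Module.Finite R I := .trans Λ I
  have : IsNoetherian R (Module.End Λ I) :=
    isNoetherian_of_injective
      (M := I →ₗ[Λ] I) (P := I →ₗ[R] I) (LinearMap.restrictScalarsₗ R Λ I I R)
      (LinearMap.restrictScalars_injective R)
  exact isNoetherian_of_tower R inferInstance

lemma exists_fin_presentation {A : Type u} [Ring A] [IsNoetherianRing A] (X : Type u)
    [AddCommGroup X] [Module A X] [Module.Finite A X] :
    ∃ (a b : ℕ) (q : (Fin b → A) →ₗ[A] (Fin a → A)) (p : (Fin a → A) →ₗ[A] X),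
      Function.Surjective p ∧ Function.Exact q p := by
  obtain ⟨a, p, hp⟩ := Module.Finite.exists_fin' A X
  obtain ⟨b, q, hq⟩ := Module.Finite.exists_fin' A (LinearMap.ker p)
  refine ⟨a, b, (LinearMap.ker p).subtype ∘ₗ q, p, hp, ?_⟩
  rw [LinearMap.exact_iff, LinearMap.range_comp, LinearMap.range_eq_top.2 hq]
  simp

end Dual

section GorensteinProjective

variable {Λ : Type u} [Ring Λ] {I : Type u} [AddCommGroup I] [Module Λ I]

/-- If `I` has projective dimension at most one, the `Λ`-dual of a finitely presented
`End_Λ(I)`-module is, up to `add I`, a second syzygy. -/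
lemma extVanishes_dual_of_presentation
    (hI : ∀ (J : Type u) [AddCommGroup J] [Module Λ J], InAdd Λ I J → ProjDimLE Λ J 1)
    {X : Type u} [AddCommGroup X] [Module (Module.End Λ I) X] {a b : ℕ}
    {q : (Fin b → Module.End Λ I) →ₗ[Module.End Λ I] (Fin a → Module.End Λ I)}
    {p : (Fin a → Module.End Λ I) →ₗ[Module.End Λ I] X}
    (hp : Function.Surjective p) (hqp : Function.Exact q p)
    {Y : Type u} [AddCommGroup Y] [Module Λ Y] {m : ℕ} (hY : InjDimLE Λ Y m) {i : ℕ}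
    (hi : 2 ≤ i) (him : m < i + 2) : ExtVanishes Λ (X →ₗ[Module.End Λ I] I) Y i := by
  have hqp' := exact_lcomp_end (Λ := Λ) hp hqp
  have hK : ExtVanishes Λ (LinearMap.range (LinearMap.lcomp Λ I q)) Y (i + 1) :=
    .left_of_shortExact (g := (LinearMap.range (LinearMap.lcomp Λ I q)).mkQ)
      Subtype.val_injective (LinearMap.exact_subtype_mkQ _) (Submodule.mkQ_surjective _)
      ((hI _ (inAdd_dual_pi b)).extVanishes Y (by lia)) (hY.extVanishes _ him)
  refine .left_of_shortExact (g := (LinearMap.lcomp Λ I q).rangeRestrict)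
    (lcomp_end_injective hp) (fun x => ?_) (LinearMap.surjective_rangeRestrict _)
    ((hI _ (inAdd_dual_pi a)).extVanishes Y hi) hK
  rw [← hqp' x, Subtype.ext_iff]
  rfl

/-- Duality with respect to `I` transports vanishing of `Ext_{End_Λ(I)}(I, N^*)` to vanishing
of `Ext_Λ(N, Λ)` in the range controlled by the `I`-dominant dimension. -/
lemma extVanishes_self_of_domdim (hIinj : Module.Injective Λ I)
    (hI : ∀ (J : Type u) [AddCommGroup J] [Module Λ J], InAdd Λ I J → Module.Injective Λ J)
    {n i : ℕ} (hdom : IDomdimGE Λ I Λ (n + 1)) (hi : i + 1 < n)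
    {N : Type u} [AddCommGroup N] [Module Λ N]
    (h : ExtVanishes (Module.End Λ I) I (N →ₗ[Λ] I) (i + 1)) : ExtVanishes Λ N Λ (i + 1) := by
  obtain ⟨J, g, f, hJ, hg, h0, hf⟩ := hdom
  replace hg := hg (by lia)
  replace h0 := h0 (by lia)
  let e : (J 0 →ₗ[Λ] I) →ₗ[Module.End Λ I] I :=
    { toFun := fun χ => χ (g 1)
      map_add' := fun _ _ => rfl
      map_smul' := fun _ _ => rfl }
  have he : Function.Surjective e := fun m => by
    obtain ⟨χ, hχ⟩ := Module.Injective.extension_property Λ I _ _ g hg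
      (LinearMap.toSpanSingleton Λ I m)
    exact ⟨χ, (LinearMap.congr_fun hχ 1).trans (one_smul Λ m)⟩
  have hfe : Function.Exact (LinearMap.lcomp (Module.End Λ I) I (f 0)) e := fun χ => by
    rw [← exact_lcomp_of_injective hIinj h0 χ]
    exact ⟨fun hχ => LinearMap.ext_ring hχ, fun hχ => LinearMap.congr_fun hχ 1⟩
  have key := (extVanishes_iff_of_projective_resolution (P := fun k => J k →ₗ[Λ] I)
    (f := fun k => LinearMap.lcomp (Module.End Λ I) I (f k)) i
    (fun k hk => (hJ k (by lia)).projective_dual) he hfe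
    (fun k hk => exact_lcomp_of_injective hIinj (hf k (by lia)))).1 h
  refine extVanishes_of_injective_coresolution i (fun k hk => hI _ (hJ k (by lia))) hg h0
    (fun k hk => hf k (by lia)) fun φ hφ => ?_
  obtain ⟨ψ, hψ⟩ := key (LinearMap.lcomp (Module.End Λ I) I φ) (LinearMap.ext fun χ => by
    change (χ ∘ₗ f (i + 1)) ∘ₗ φ = 0
    rw [LinearMap.comp_assoc, hφ, LinearMap.comp_zero])
  obtain ⟨θ, hθ⟩ := (hJ i (by lia)).exists_lcomp_eq ψ
  refine ⟨θ, (hJ (i + 1) (by lia)).eq_of_lcomp_eq fun χ => ?_⟩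
  rw [← LinearMap.comp_assoc, hθ]
  exact LinearMap.congr_fun hψ χ

end GorensteinProjective


/-- Let `Λ` be an almost `n`-minimal Auslander-Gorenstein algebra (`n ≥ 2`),
`A = End_Λ(I)`, `M = I` as an `A`-module. If `X` is a finitely generated `A`-module with
`Ext^i_A(M,X) = 0` for `1 ≤ i ≤ n-1`, then the `Λ`-module `Hom_A(X,M)` is Gorenstein
projective, i.e. `Ext^i_Λ(Hom_A(X,M),Λ) = 0` for all `i ≥ 1`. -/
theorem stmt15 (R : Type u) [CommRing R] [IsArtinianRing R]
    (Λ : Type u) [Ring Λ] [Algebra R Λ] [Module.Finite R Λ]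
    (n : ℕ) (hn : 2 ≤ n)
    (I : Type u) [AddCommGroup I] [Module Λ I] [Module.Finite Λ I]
    (hIinj : Module.Injective Λ I) (hIpd : ProjDimLE Λ I 1)
    (haddI : ∀ (J : Type u) [AddCommGroup J] [Module Λ J], Module.Finite Λ J →
      ((Module.Injective Λ J ∧ ProjDimLE Λ J 1) ↔ InAdd Λ I J))
    (hid : InjDimLE Λ Λ (n + 1))
    (hdom : IDomdimGE Λ I Λ (n + 1))
    (X : Type u) [AddCommGroup X] [Module (Module.End Λ I) X]
    (hXfin : Module.Finite (Module.End Λ I) X)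
    (hX : ∀ i : ℕ, 1 ≤ i → i ≤ n - 1 → ExtVanishes (Module.End Λ I) I X i) :
    ∀ i : ℕ, 1 ≤ i → ExtVanishes Λ (X →ₗ[Module.End Λ I] I) Λ i := by

  intro i hi
  have hadd (J : Type u) [AddCommGroup J] [Module Λ J] (hJ : InAdd Λ I J) :
      Module.Injective Λ J ∧ ProjDimLE Λ J 1 := (haddI J hJ.finite).2 hJ
  have : IsNoetherianRing (Module.End Λ I) := isNoetherianRing_end R Λ I
  obtain ⟨a, b, q, p, hp, hqp⟩ := exists_fin_presentation (A := Module.End Λ I) X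
  obtain hin | hin := lt_or_ge i n
  · obtain ⟨i, rfl⟩ := Nat.exists_eq_add_one_of_ne_zero (Nat.ne_zero_of_lt hi)
    exact extVanishes_self_of_domdim hIinj (fun J _ _ hJ => (hadd J hJ).1) hdom hin
      ((hX _ hi (by lia)).of_linearEquiv (.ofBijective _ (evalDual_bijective_of_presentation
        hIinj hp hqp (evalDual_pi_bijective a) (evalDual_pi_bijective b).2)))
  · exact extVanishes_dual_of_presentation (fun J _ _ hJ => (hadd J hJ).2) hp hqp hid
      (hn.trans hin) (by lia)
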